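/- arXiv:1010.1128 — 2 statements merged into one kernel-verified Lean document; each statement's English description precedes it below -/
import Mathlib

section
/- Let R be a constructor TRS over a signature F and let ⊥ be a fresh constant constructor. Define R⊥ := {t → ⊥ : t ∈ T(F ∪ {⊥}, V) ∩ NF(R) and the root symbol of t is defined}. Then R ∪ R⊥ is completely defined, and moreover: if s i→_R^ℓ t (ℓ innermost R-steps), then there exist a term t' and ℓ' ≥ ℓ such that s i→_{R ∪ R⊥}^{ℓ'} t'. -/
set_option maxHeartbeats 1000000

/-- First-order terms over a signature `F`, with variables drawn from `ℕ`. -/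
inductive Tm (F : Type) : Type
  | var : ℕ → Tm F
  | fn  : F → List (Tm F) → Tm F

instance {F : Type} : Inhabited (Tm F) := ⟨Tm.var 0⟩

/-- The size `|t|` of a term. -/
def Tm.size {F} : Tm F → ℕ
  | .var _ => 1
  | .fn _ ts => 1 + (ts.attach.map fun t => t.1.size).sum
decreasing_by have := List.sizeOf_lt_of_mem t.2; simp_wf; omega

/-- The depth of a term (variables and constants have depth 0). -/
def Tm.depth {F} : Tm F → ℕ
  | .var _ => 0
  | .fn _ [] => 0
  | .fn f (t :: ts) => max (t.depth + 1) (Tm.fn f ts).depth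

/-- A (quasi-)precedence: a preorder `le` (i.e. `f ≿ g`) on the signature whose
strict part `≻` is well-founded. -/
structure Precedence (F : Type) where
  le : F → F → Prop
  refl : ∀ f, le f f
  trans : ∀ {f g h}, le f g → le g h → le f h
  wf : WellFounded (fun g f => le f g ∧ ¬ le g f)

/-- The strict part `f ≻ g` of a precedence. -/
def Precedence.strict {F} (P : Precedence F) (f g : F) : Prop := P.le f g ∧ ¬ P.le g f

/-- The equivalence part `f ∼ g` of a precedence. -/
def Precedence.equiv {F} (P : Precedence F) (f g : F) : Prop := P.le f g ∧ P.le g f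

/-- Constructor terms: terms built from constructors and variables only. -/
inductive IsCtorTerm {F} (D : F → Bool) : Tm F → Prop
  | var (v) : IsCtorTerm D (.var v)
  | fn {f : F} {ts : List (Tm F)} :
      D f = false → (∀ t ∈ ts, IsCtorTerm D t) → IsCtorTerm D (.fn f ts)

/-- Basic terms: a defined root symbol applied to constructor terms. -/
def Basic {F} (D : F → Bool) (t : Tm F) : Prop :=
  ∃ f ts, t = Tm.fn f ts ∧ D f = true ∧ ∀ s ∈ ts, IsCtorTerm D s

/-- Application of a substitution `σ : V → T(F,V)` to a term. -/
def subst {F} (σ : ℕ → Tm F) : Tm F → Tm F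
  | .var v => σ v
  | .fn f ts => .fn f (ts.attach.map fun t => subst σ t.1)
decreasing_by have := List.sizeOf_lt_of_mem t.2; simp_wf; omega

/-- The variable `v` occurs in the term. -/
inductive VarIn {F} (v : ℕ) : Tm F → Prop
  | var : VarIn v (.var v)
  | fn {f : F} {ts : List (Tm F)} {t : Tm F} : t ∈ ts → VarIn v t → VarIn v (.fn f ts)

/-- A term rewrite system: left-hand sides are not variables and all variables
of a right-hand side occur in the corresponding left-hand side. -/
def IsTRS {F} (R : Set (Tm F × Tm F)) : Prop :=
  ∀ lr ∈ R, (∀ v, lr.1 ≠ Tm.var v) ∧ (∀ v, VarIn v lr.2 → VarIn v lr.1)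

/-- A constructor TRS: all left-hand sides are basic terms. -/
def ConstructorTRS {F} (D : F → Bool) (R : Set (Tm F × Tm F)) : Prop :=
  ∀ lr ∈ R, Basic D lr.1

/-- The rewrite relation `→_R` induced by `R`. -/
inductive Rew {F} (R : Set (Tm F × Tm F)) : Tm F → Tm F → Prop
  | root {l r : Tm F} {σ : ℕ → Tm F} :
      (l, r) ∈ R → Rew R (subst σ l) (subst σ r)
  | congr {f : F} {pre post : List (Tm F)} {s t : Tm F} :
      Rew R s t → Rew R (.fn f (pre ++ s :: post)) (.fn f (pre ++ t :: post))

/-- `t` is an `R`-normal form. -/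
def NFo {F} (R : Set (Tm F × Tm F)) (t : Tm F) : Prop := ∀ u, ¬ Rew R t u

/-- The innermost rewrite relation `i→_R`: contracted redexes have all their
proper subterms in normal form. -/
inductive IRew {F} (R : Set (Tm F × Tm F)) : Tm F → Tm F → Prop
  | root {l r : Tm F} {σ : ℕ → Tm F} :
      (l, r) ∈ R →
      (∀ f us, subst σ l = Tm.fn f us → ∀ u ∈ us, NFo R u) →
      IRew R (subst σ l) (subst σ r)
  | congr {f : F} {pre post : List (Tm F)} {s t : Tm F} :
      IRew R s t → IRew R (.fn f (pre ++ s :: post)) (.fn f (pre ++ t :: post))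

/-- `R` is completely defined: no defined symbol occurs in any normal form. -/
def CompletelyDefined {F} (D : F → Bool) (R : Set (Tm F × Tm F)) : Prop :=
  ∀ t, NFo R t → IsCtorTerm D t

/-- `Steps r n s t`: a derivation of length `n` from `s` to `t`. -/
def Steps {α} (r : α → α → Prop) : ℕ → α → α → Prop
  | 0, s, t => s = t
  | n + 1, s, t => ∃ u, r s u ∧ Steps r n u t

/-- The innermost runtime complexity `rc^i_R(n)`: the supremum (in `ℕ∞`) of
the lengths of innermost derivations starting from basic terms of size at
most `n`. -/
noncomputable def rcI {F} (D : F → Bool) (R : Set (Tm F × Tm F)) (n : ℕ) : ℕ∞ :=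
  sSup {m : ℕ∞ | ∃ (k : ℕ) (t u : Tm F),
    m = (k : ℕ∞) ∧ Basic D t ∧ t.size ≤ n ∧ Steps (IRew R) k t u}

/-- The set `Tn`: constructor terms, and terms whose normal arguments are
constructor terms and whose safe arguments are again in `Tn`. -/
inductive TnSet {F} (D : F → Bool) (nrm : F → ℕ) : Tm F → Prop
  | ctor {t : Tm F} : IsCtorTerm D t → TnSet D nrm t
  | fn {f : F} {ts : List (Tm F)} :
      (∀ i, i < nrm f → i < ts.length → IsCtorTerm D (ts.getD i default)) →
      (∀ i, nrm f ≤ i → i < ts.length → TnSet D nrm (ts.getD i default)) →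
      TnSet D nrm (.fn f ts)

/-- Renaming of function symbols in a term. -/
def Tm.mapSym {F G} (h : F → G) : Tm F → Tm G
  | .var v => .var v
  | .fn f ts => .fn (h f) (ts.attach.map fun t => t.1.mapSym h)
decreasing_by have := List.sizeOf_lt_of_mem t.2; simp_wf; omega

/-- The defined symbols of the signature `F ∪ {⊥}` (`none` is the fresh
constructor `⊥`). -/
def liftOptD {F} (D : F → Bool) : Option F → Bool := fun o => o.elim false D

/-- The safe mapping on the signature `F ∪ {⊥}`. -/
def liftOptNrm {F} (nrm : F → ℕ) : Option F → ℕ := fun o => o.elim 0 nrm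

/-- A TRS over `F` viewed as a TRS over `F ∪ {⊥}`. -/
def embR {F} (R : Set (Tm F × Tm F)) : Set (Tm (Option F) × Tm (Option F)) :=
  {p | ∃ lr ∈ R, p = (Tm.mapSym some lr.1, Tm.mapSym some lr.2)}

/-- The TRS `R⊥`: rules `t → ⊥` for every `R`-normal form
`t ∈ T(F ∪ {⊥}, V)` whose root symbol is defined. -/
def botRules {F} (D : F → Bool) (R : Set (Tm F × Tm F)) :
    Set (Tm (Option F) × Tm (Option F)) :=
  {p | NFo (embR R) p.1 ∧ (∃ f ts, p.1 = Tm.fn (some f) ts ∧ D f = true) ∧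
       p.2 = Tm.fn none []}

theorem Tm.induct {F : Type} {P : Tm F → Prop} (hvar : ∀ v, P (.var v))
    (hfn : ∀ f ts, (∀ t ∈ ts, P t) → P (.fn f ts)) : ∀ t, P t
  | .var v => hvar v
  | .fn f ts => hfn f ts fun t _ => Tm.induct hvar hfn t
decreasing_by
  have := List.sizeOf_lt_of_mem ‹t ∈ ts›
  simp_wf; omega

section Substitution

variable {F : Type}

theorem subst_var (σ : ℕ → Tm F) (v : ℕ) : subst σ (.var v) = σ v := by
  rw [subst]

theorem subst_fn (σ : ℕ → Tm F) (f : F) (ts : List (Tm F)) :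
    subst σ (.fn f ts) = .fn f (ts.map (subst σ)) := by
  rw [subst, List.attach_map_val]

theorem mapSym_fn {G : Type} (h : F → G) (f : F) (ts : List (Tm F)) :
    Tm.mapSym h (.fn f ts) = .fn (h f) (ts.map (Tm.mapSym h)) := by
  rw [Tm.mapSym, List.attach_map_val]

theorem subst_id (t : Tm F) : subst Tm.var t = t := by
  induction t using Tm.induct with
  | hvar v => exact subst_var _ v
  | hfn f ts ih => rw [subst_fn, List.map_congr_left ih, List.map_id']

theorem subst_subst (σ τ : ℕ → Tm F) (t : Tm F) :
    subst τ (subst σ t) = subst (fun v => subst τ (σ v)) t := by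
  induction t using Tm.induct with
  | hvar v => simp only [subst_var]
  | hfn f ts ih =>
    simp only [subst_fn, List.map_map]
    exact congrArg _ (List.map_congr_left ih)

/-- The term `f(x₀, …, xₙ₋₁)` has every `f(t₀, …, tₙ₋₁)` as an instance. -/
theorem subst_getD_range (f : F) (g : Tm F → Tm F) (ts : List (Tm F)) :
    subst (fun i => g (ts.getD i default)) (.fn f ((List.range ts.length).map Tm.var)) =
      .fn f (ts.map g) := by
  rw [subst_fn, List.map_map]
  congr 1
  apply List.ext_getElem
  · simp
  · intro i h₁ h₂
    have hi : i < ts.length := by simpa using h₂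
    simp [subst_var, hi]

end Substitution

section Rewriting

variable {F : Type} {R : Set (Tm F × Tm F)}

theorem Rew.subst {s t : Tm F} (h : Rew R s t) (τ : ℕ → Tm F) :
    Rew R (subst τ s) (subst τ t) := by
  induction h with
  | root hlr => simpa only [subst_subst] using Rew.root hlr
  | congr _ ih => simpa only [subst_fn, List.map_append, List.map_cons] using Rew.congr ih

theorem IRew.rew {s t : Tm F} (h : IRew R s t) : Rew R s t := by
  induction h with
  | root hlr _ => exact .root hlr
  | congr _ ih => exact .congr ih

theorem NFo.of_subst {τ : ℕ → Tm F} {t : Tm F} (h : NFo R (subst τ t)) : NFo R t :=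
  fun _ hu => h _ (hu.subst τ)

theorem NFo.arg {f : F} {ts : List (Tm F)} (h : NFo R (.fn f ts)) {t : Tm F} (ht : t ∈ ts) :
    NFo R t := by
  obtain ⟨pre, post, rfl⟩ := List.append_of_mem ht
  exact fun _ hu => h _ (.congr hu)

theorem NFo.mono {S : Set (Tm F × Tm F)} (hRS : R ⊆ S) {t : Tm F} (h : NFo S t) : NFo R t := by
  have mono : ∀ {s u : Tm F}, Rew R s u → Rew S s u := fun hr => by
    induction hr with
    | root hlr => exact .root (hRS hlr)
    | congr _ ih => exact .congr ih
  exact fun _ hu => h _ (mono hu)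

/-- The root symbol of every left-hand side is defined. -/
def DefinedRoots (D : F → Bool) (R : Set (Tm F × Tm F)) : Prop :=
  ∀ lr ∈ R, ∃ f ts, lr.1 = .fn f ts ∧ D f = true

theorem ConstructorTRS.definedRoots {D : F → Bool} (h : ConstructorTRS D R) :
    DefinedRoots D R := fun lr hlr =>
  let ⟨f, ts, hl, hf, _⟩ := h lr hlr
  ⟨f, ts, hl, hf⟩

theorem IsCtorTerm.nfo {D : F → Bool} (hR : DefinedRoots D R) {t : Tm F}
    (ht : IsCtorTerm D t) : NFo R t := by
  intro u hu
  induction hu with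
  | @root l r σ hlr =>
    obtain ⟨f, ts, rfl, hf⟩ := hR _ hlr
    rw [subst_fn] at ht
    cases ht with
    | fn hf' _ => simp [hf] at hf'
  | congr _ ih =>
    cases ht with
    | fn _ hts => exact ih (hts _ (by simp))

end Rewriting

/-- There is a derivation of length at least `k`. -/
def StepsGE {α : Type} (r : α → α → Prop) (k : ℕ) (a b : α) : Prop :=
  ∃ n, k ≤ n ∧ Steps r n a b

section StepsGE

variable {α : Type} {r : α → α → Prop} {a b c : α} {k m : ℕ}

theorem Steps.trans (h₁ : Steps r m a b) (h₂ : Steps r k b c) : Steps r (m + k) a c := by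
  induction m generalizing a with
  | zero => cases h₁; simpa using h₂
  | succ m ih =>
    obtain ⟨u, hu, h⟩ := h₁
    rw [Nat.add_right_comm]
    exact ⟨u, hu, ih h⟩

theorem StepsGE.trans (h₁ : StepsGE r m a b) (h₂ : StepsGE r k b c) :
    StepsGE r (m + k) a c :=
  let ⟨n₁, hn₁, h₁⟩ := h₁
  let ⟨n₂, hn₂, h₂⟩ := h₂
  ⟨n₁ + n₂, Nat.add_le_add hn₁ hn₂, h₁.trans h₂⟩

theorem StepsGE.refl (a : α) : StepsGE r 0 a a := ⟨0, le_rfl, rfl⟩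

theorem StepsGE.single (h : r a b) : StepsGE r 1 a b := ⟨1, le_rfl, b, h, rfl⟩

theorem StepsGE.mono (hmk : m ≤ k) (h : StepsGE r k a b) : StepsGE r m a b :=
  let ⟨n, hn, h⟩ := h
  ⟨n, hmk.trans hn, h⟩

theorem StepsGE.map {β : Type} {q : β → β → Prop} (g : α → β)
    (hg : ∀ x y, r x y → q (g x) (g y)) (h : StepsGE r k a b) : StepsGE q k (g a) (g b) := by
  obtain ⟨n, hn, h⟩ := h
  refine ⟨n, hn, ?_⟩
  clear hn
  induction n generalizing a with
  | zero => exact congrArg g h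
  | succ n ih =>
    obtain ⟨u, hu, h⟩ := h
    exact ⟨g u, hg _ _ hu, ih h⟩

theorem StepsGE.args {F : Type} {R : Set (Tm F × Tm F)} (f : F) (g h : Tm F → Tm F)
    (pre ts : List (Tm F)) (H : ∀ t ∈ ts, StepsGE (IRew R) 0 (g t) (h t)) :
    StepsGE (IRew R) 0 (.fn f (pre ++ ts.map g)) (.fn f (pre ++ ts.map h)) := by
  induction ts generalizing pre with
  | nil => exact .refl _
  | cons t ts ih =>
    have h₁ : StepsGE (IRew R) 0 (.fn f (pre ++ g t :: ts.map g))
        (.fn f (pre ++ h t :: ts.map g)) :=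
      (H t (by simp)).map (fun u => Tm.fn f (pre ++ u :: ts.map g)) fun _ _ hr => IRew.congr hr
    have h₂ := ih (pre ++ [h t]) fun u hu => H u (by simp [hu])
    simp only [List.append_assoc, List.singleton_append] at h₂
    exact h₁.trans h₂

end StepsGE

/-- The rules `t → c` for all `R`-normal forms `t` with defined root symbol. -/
def collapseRules {F : Type} (D : F → Bool) (R : Set (Tm F × Tm F)) (c : F) :
    Set (Tm F × Tm F) :=
  {p | NFo R p.1 ∧ (∃ f ts, p.1 = Tm.fn f ts ∧ D f = true) ∧ p.2 = Tm.fn c []}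

open Classical in
/-- Replace all maximal `R`-normal subterms with defined root symbol by the constant `c`. -/
noncomputable def collapse {F : Type} (D : F → Bool) (R : Set (Tm F × Tm F)) (c : F) :
    Tm F → Tm F
  | .var v => .var v
  | .fn f ts => if D f = true ∧ NFo R (.fn f ts) then .fn c []
      else .fn f (ts.attach.map fun t => collapse D R c t.1)
decreasing_by have := List.sizeOf_lt_of_mem t.2; simp_wf; omega

section Collapse

variable {F : Type} {D : F → Bool} {R : Set (Tm F × Tm F)} {c : F}

theorem collapse_var (v : ℕ) : collapse D R c (.var v) = .var v := by
  rw [collapse]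

theorem collapse_fn_of_nfo {f : F} {ts : List (Tm F)} (hf : D f = true)
    (h : NFo R (.fn f ts)) : collapse D R c (.fn f ts) = .fn c [] := by
  rw [collapse, if_pos ⟨hf, h⟩]

theorem collapse_fn_of_not {f : F} {ts : List (Tm F)}
    (h : ¬ (D f = true ∧ NFo R (.fn f ts))) :
    collapse D R c (.fn f ts) = .fn f (ts.map (collapse D R c)) := by
  rw [collapse, if_neg h, List.attach_map_val]

theorem collapse_fn_of_rew {f : F} {ts : List (Tm F)} {u : Tm F} (h : Rew R (.fn f ts) u) :
    collapse D R c (.fn f ts) = .fn f (ts.map (collapse D R c)) :=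
  collapse_fn_of_not fun hn => hn.2 _ h

theorem isCtorTerm_collapse (hc : D c = false) {t : Tm F} (ht : NFo R t) :
    IsCtorTerm D (collapse D R c t) := by
  induction t using Tm.induct with
  | hvar v => rw [collapse_var]; exact .var v
  | hfn f ts ih =>
    by_cases hf : D f = true
    · rw [collapse_fn_of_nfo hf ht]
      exact .fn hc (by simp)
    · rw [collapse_fn_of_not fun h => hf h.1]
      refine .fn (by simpa using hf) fun u hu => ?_
      obtain ⟨t, htm, rfl⟩ := List.mem_map.1 hu
      exact ih t htm (ht.arg htm)

theorem collapse_subst_of_isCtorTerm {l : Tm F} (hl : IsCtorTerm D l) (σ : ℕ → Tm F) :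
    collapse D R c (subst σ l) = subst (fun v => collapse D R c (σ v)) l := by
  induction hl with
  | var v => simp only [subst_var]
  | @fn f ts hf _ ih =>
    rw [subst_fn, subst_fn, collapse_fn_of_not (by simp [hf]), List.map_map]
    exact congrArg _ (List.map_congr_left ih)

theorem completelyDefined_union_collapseRules :
    CompletelyDefined D (R ∪ collapseRules D R c) := by
  intro t ht
  induction t using Tm.induct with
  | hvar v => exact .var v
  | hfn f ts ih =>
    refine .fn ?_ fun t htm => ih t htm (ht.arg htm)
    by_contra hf
    refine ht _ (subst_id (.fn f ts) ▸ Rew.root (σ := Tm.var) (r := .fn c []) (Or.inr ?_))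
    exact ⟨ht.mono Set.subset_union_left, ⟨f, ts, rfl, by simpa using hf⟩, rfl⟩

theorem definedRoots_union_collapseRules (hR : ConstructorTRS D R) :
    DefinedRoots D (R ∪ collapseRules D R c) := by
  rintro lr (h | h)
  · exact hR.definedRoots lr h
  · exact h.2.1

theorem nfo_collapse (hR : ConstructorTRS D R) (hc : D c = false) {t : Tm F} (ht : NFo R t) :
    NFo (R ∪ collapseRules D R c) (collapse D R c t) :=
  (isCtorTerm_collapse hc ht).nfo (definedRoots_union_collapseRules hR)

theorem stepsGE_collapse_fn (hR : ConstructorTRS D R) (hc : D c = false) (f : F)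
    (ts : List (Tm F)) :
    StepsGE (IRew (R ∪ collapseRules D R c)) 0 (.fn f (ts.map (collapse D R c)))
      (collapse D R c (.fn f ts)) := by
  by_cases h : D f = true ∧ NFo R (.fn f ts)
  · obtain ⟨hf, hn⟩ := h
    rw [collapse_fn_of_nfo hf hn, ← subst_getD_range]
    have hp : NFo R (.fn f ((List.range ts.length).map Tm.var)) := by
      apply NFo.of_subst (τ := fun i => id (ts.getD i default))
      rwa [subst_getD_range, List.map_id]
    have hstep := IRew.root (R := R ∪ collapseRules D R c)
      (σ := fun i => collapse D R c (ts.getD i default))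
      (Or.inr ⟨hp, ⟨f, _, rfl, hf⟩, rfl⟩) (by
        intro g us hg u hu
        rw [subst_getD_range] at hg
        cases hg
        obtain ⟨t, htm, rfl⟩ := List.mem_map.1 hu
        exact nfo_collapse hR hc (hn.arg htm))
    rw [subst_fn _ c] at hstep
    exact (StepsGE.single hstep).mono zero_le_one
  · rw [collapse_fn_of_not h]
    exact .refl _

theorem stepsGE_subst_collapse (hR : ConstructorTRS D R) (hc : D c = false)
    {σ τ : ℕ → Tm F}
    (h : ∀ v, StepsGE (IRew (R ∪ collapseRules D R c)) 0 (τ v) (collapse D R c (σ v)))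
    (t : Tm F) :
    StepsGE (IRew (R ∪ collapseRules D R c)) 0 (subst τ t) (collapse D R c (subst σ t)) := by
  induction t using Tm.induct with
  | hvar v => simpa only [subst_var] using h v
  | hfn f ts ih =>
    have hargs := StepsGE.args f _ _ [] ts ih
    have hroot := stepsGE_collapse_fn hR hc f (ts.map (subst σ))
    rw [List.map_map] at hroot
    simp only [subst_fn]
    exact hargs.trans hroot

theorem stepsGE_collapse_of_iRew (hR : ConstructorTRS D R) (hc : D c = false) {s t : Tm F}
    (h : IRew R s t) :
    StepsGE (IRew (R ∪ collapseRules D R c)) 1 (collapse D R c s) (collapse D R c t) := by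
  induction h with
  | @root l r σ hlr hargs =>
    obtain ⟨f, ls, rfl, -, hls⟩ := hR _ hlr
    have hl : collapse D R c (subst σ (.fn f ls)) =
        subst (fun v => collapse D R c (σ v)) (.fn f ls) := by
      have hrew := Rew.root (σ := σ) hlr
      rw [subst_fn] at hrew
      rw [subst_fn, subst_fn, collapse_fn_of_rew hrew, List.map_map]
      exact congrArg _
        (List.map_congr_left fun l hl => collapse_subst_of_isCtorTerm (hls l hl) σ)
    rw [hl]
    refine (StepsGE.single (.root (Or.inl hlr) ?_)).trans
      (stepsGE_subst_collapse hR hc (fun v => .refl _) r)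
    intro g us hg u hu
    rw [subst_fn] at hg
    cases hg
    obtain ⟨l, hlm, rfl⟩ := List.mem_map.1 hu
    rw [← collapse_subst_of_isCtorTerm (hls l hlm)]
    exact nfo_collapse hR hc (hargs _ _ (subst_fn σ f ls) _ (List.mem_map_of_mem hlm))
  | @congr f pre post s t h ih =>
    rw [collapse_fn_of_rew (Rew.congr h.rew), List.map_append, List.map_cons]
    have hstep := ih.map (q := IRew (R ∪ collapseRules D R c))
      (fun u => Tm.fn f (pre.map (collapse D R c) ++ u :: post.map (collapse D R c)))
      fun _ _ hr => IRew.congr hr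
    have hroot := stepsGE_collapse_fn hR hc f (pre ++ t :: post)
    rw [List.map_append, List.map_cons] at hroot
    exact hstep.trans hroot

theorem stepsGE_collapse_of_steps (hR : ConstructorTRS D R) (hc : D c = false) {l : ℕ}
    {s t : Tm F} (h : Steps (IRew R) l s t) :
    StepsGE (IRew (R ∪ collapseRules D R c)) l (collapse D R c s) (collapse D R c t) := by
  induction l generalizing s with
  | zero => cases h; exact .refl _
  | succ l ih =>
    obtain ⟨u, hu, h⟩ := h
    rw [Nat.add_comm]
    exact (stepsGE_collapse_of_iRew hR hc hu).trans (ih h)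

theorem stepsGE_of_steps (hR : ConstructorTRS D R) (hc : D c = false) {l : ℕ}
    {s t : Tm F} (h : Steps (IRew R) l s t) :
    StepsGE (IRew (R ∪ collapseRules D R c)) l s (collapse D R c t) := by
  have hs := stepsGE_subst_collapse (σ := Tm.var) (τ := Tm.var) hR hc
    (fun v => by rw [collapse_var]; exact .refl _) s
  rw [subst_id] at hs
  exact (hs.trans (stepsGE_collapse_of_steps hR hc h)).mono (by omega)

end Collapse

section Embedding

variable {F : Type} {D : F → Bool} {R : Set (Tm F × Tm F)}

theorem IsCtorTerm.mapSym_some {t : Tm F} (ht : IsCtorTerm D t) :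
    IsCtorTerm (liftOptD D) (Tm.mapSym some t) := by
  induction ht with
  | var v => rw [Tm.mapSym]; exact .var v
  | fn hf _ ih =>
    rw [mapSym_fn]
    refine .fn hf fun u hu => ?_
    obtain ⟨t, ht, rfl⟩ := List.mem_map.1 hu
    exact ih t ht

theorem ConstructorTRS.embR (hR : ConstructorTRS D R) :
    ConstructorTRS (liftOptD D) (embR R) := by
  rintro _ ⟨lr, hlr, rfl⟩
  obtain ⟨f, ts, hl, hf, hts⟩ := hR lr hlr
  refine ⟨some f, ts.map (Tm.mapSym some), by rw [hl, mapSym_fn], hf, fun u hu => ?_⟩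
  obtain ⟨t, ht, rfl⟩ := List.mem_map.1 hu
  exact (hts t ht).mapSym_some

theorem botRules_eq_collapseRules (D : F → Bool) (R : Set (Tm F × Tm F)) :
    botRules D R = collapseRules (liftOptD D) (embR R) none := by
  ext p
  refine and_congr_right fun _ => and_congr_left fun _ => ⟨?_, ?_⟩
  · rintro ⟨f, ts, hp, hf⟩
    exact ⟨some f, ts, hp, hf⟩
  · rintro ⟨_ | f, ts, hp, hf⟩
    · exact absurd hf Bool.false_ne_true
    · exact ⟨f, ts, hp, hf⟩

end Embedding

/-- Lemma 4.16: for a constructor TRS `R` and fresh constructor `⊥`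
(`R⊥ = {t → ⊥ ∣ t ∈ T(F ∪ {⊥}, V) ∩ NF(R)`, root of `t` defined`}`), the TRS
`R ∪ R⊥` is completely defined, and every innermost `R`-derivation of length
`ℓ` can be extended to an innermost `R ∪ R⊥`-derivation of length `ℓ' ≥ ℓ`. -/
theorem completely_defined_extension {F : Type} (D : F → Bool)
    (R : Set (Tm F × Tm F)) (hTRS : IsTRS R) (hctor : ConstructorTRS D R) :
    CompletelyDefined (liftOptD D) (embR R ∪ botRules D R) ∧
    (∀ (s t : Tm (Option F)) (l : ℕ), Steps (IRew (embR R)) l s t →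
      ∃ (t' : Tm (Option F)) (l' : ℕ), l ≤ l' ∧
        Steps (IRew (embR R ∪ botRules D R)) l' s t') := by
  rw [botRules_eq_collapseRules]
  refine ⟨completelyDefined_union_collapseRules, fun s t l h => ?_⟩
  exact ⟨_, stepsGE_of_steps hctor.embR rfl h⟩
end

section
/- Consider the TRS R_d consisting of the rules d(x) → c(x, x), f(0, y) → y, f(s(x), y) → f(x, d(f(x, y))). For every term t whose derivation height dl(t, →_{R_d}) with respect to full rewriting is finite, and for every n > 0, dl(f(s^n(0), t), →_{R_d}) ≥ 2^{2^{n−1}} · (1 + dl(t, →_{R_d})). -/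
set_option maxHeartbeats 1000000

/-- The signature of `R_d`: defined symbols `f`, `d`; constructors `c`, `s`,
`z` (i.e. `0`). -/
inductive DSig : Type
  | f | d | c | s | z

def dxv : Tm DSig := Tm.var 0
def dyv : Tm DSig := Tm.var 1
def dzeroT : Tm DSig := Tm.fn DSig.z []
def dsT (t : Tm DSig) : Tm DSig := Tm.fn DSig.s [t]
def dT (t : Tm DSig) : Tm DSig := Tm.fn DSig.d [t]
def cT (a b : Tm DSig) : Tm DSig := Tm.fn DSig.c [a, b]
def fT (a b : Tm DSig) : Tm DSig := Tm.fn DSig.f [a, b]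

/-- The TRS `R_d`: `d(x) → c(x,x)`, `f(0,y) → y`, `f(s(x),y) → f(x,d(f(x,y)))`. -/
def Rd : Set (Tm DSig × Tm DSig) :=
  {(dT dxv, cT dxv dxv),
   (fT dzeroT dyv, dyv),
   (fT (dsT dxv) dyv, fT dxv (dT (fT dxv dyv)))}

/-- `sⁿ(0)`. -/
def numeral : ℕ → Tm DSig
  | 0 => dzeroT
  | n + 1 => dsT (numeral n)

theorem Steps.append {α} {r : α → α → Prop} {m n : ℕ} {a b c : α}
    (hab : Steps r m a b) (hbc : Steps r n b c) : Steps r (m + n) a c := by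
  induction m generalizing a with
  | zero =>
    obtain rfl : a = b := hab
    simpa using hbc
  | succ m ih =>
    obtain ⟨u, hau, hub⟩ := hab
    rw [Nat.add_right_comm]
    exact ⟨u, hau, ih hub⟩

theorem Steps.congr_arg {F} {R : Set (Tm F × Tm F)} (f : F) (pre post : List (Tm F))
    {n : ℕ} {s t : Tm F} (h : Steps (Rew R) n s t) :
    Steps (Rew R) n (.fn f (pre ++ s :: post)) (.fn f (pre ++ t :: post)) := by
  induction n generalizing s with
  | zero =>
    obtain rfl : s = t := h
    rfl
  | succ n ih =>
    obtain ⟨u, hsu, hut⟩ := h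
    exact ⟨_, .congr hsu, ih hut⟩

theorem rew_dT (t : Tm DSig) : Rew Rd (dT t) (cT t t) := by
  have h : Rew Rd (subst (fun _ => t) (dT dxv)) (subst (fun _ => t) (cT dxv dxv)) :=
    .root (by simp [Rd])
  simpa [subst, dT, cT, dxv] using h

theorem rew_fT_zero (t : Tm DSig) : Rew Rd (fT dzeroT t) t := by
  have h : Rew Rd (subst (fun _ => t) (fT dzeroT dyv)) (subst (fun _ => t) dyv) :=
    .root (by simp [Rd])
  simpa [subst, fT, dzeroT, dyv] using h

theorem rew_fT_succ (a t : Tm DSig) : Rew Rd (fT (dsT a) t) (fT a (dT (fT a t))) := by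
  let σ : ℕ → Tm DSig := fun v => if v = 0 then a else t
  have h : Rew Rd (subst σ (fT (dsT dxv) dyv)) (subst σ (fT dxv (dT (fT dxv dyv)))) :=
    .root (by simp [Rd])
  simpa [subst, fT, dsT, dT, dxv, dyv, σ] using h

/-- Contracting `d(t)` first duplicates a derivation of `t`. -/
theorem exists_steps_dT {t u : Tm DSig} {k : ℕ} (h : Steps (Rew Rd) k t u) :
    ∃ v, Steps (Rew Rd) (k + k + 1) (dT t) v :=
  ⟨cT u u, cT t t, rew_dT t, (h.congr_arg DSig.c [] [t]).append (h.congr_arg DSig.c [u] [])⟩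

theorem exists_steps_fT_numeral (n : ℕ) {t u : Tm DSig} {k : ℕ} (h : Steps (Rew Rd) k t u) :
    ∃ m v, Steps (Rew Rd) m (fT (numeral (n + 1)) t) v ∧ 2 ^ 2 ^ n * (1 + k) ≤ m := by
  induction n generalizing t u k with
  | zero =>
    have h₀ : Steps (Rew Rd) (k + 1) (fT dzeroT t) u := ⟨t, rew_fT_zero t, h⟩
    obtain ⟨v, hv⟩ := exists_steps_dT h₀
    refine ⟨k + 1 + (k + 1) + 1 + 1 + 1, v, ⟨_, rew_fT_succ dzeroT t, ⟨_, rew_fT_zero _, hv⟩⟩, ?_⟩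
    norm_num
    omega
  | succ n ih =>
    obtain ⟨m, v, hv, hm⟩ := ih h
    obtain ⟨w, hw⟩ := exists_steps_dT hv
    obtain ⟨m', x, hx, hm'⟩ := ih hw
    refine ⟨m' + 1, x, ⟨_, rew_fT_succ _ t, hx⟩, ?_⟩
    calc 2 ^ 2 ^ (n + 1) * (1 + k) = 2 ^ 2 ^ n * (2 ^ 2 ^ n * (1 + k)) := by
          rw [pow_succ 2 n, pow_mul]; ring
      _ ≤ 2 ^ 2 ^ n * (1 + (m + m + 1)) := Nat.mul_le_mul_left _ (by omega)
      _ ≤ m' + 1 := by omega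

/-- The runtime of `R_d` under full rewriting grows faster than any
exponential: if `dl(t, →_{R_d}) = dt` is finite, then for `n > 0`,
`dl(f(sⁿ(0), t), →_{R_d}) ≥ 2^(2^(n-1)) · (1 + dl(t, →_{R_d}))`. -/
theorem rd_lower_bound (t : Tm DSig) (dt : ℕ)
    (hreach : ∃ u, Steps (Rew Rd) dt t u)
    (hmax : ∀ (m : ℕ) (u : Tm DSig), Steps (Rew Rd) m t u → m ≤ dt)
    (n : ℕ) (hn : 0 < n) :
    ∃ (m : ℕ) (u : Tm DSig),
      Steps (Rew Rd) m (fT (numeral n) t) u ∧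
      2 ^ 2 ^ (n - 1) * (1 + dt) ≤ m := by
  obtain ⟨u, hu⟩ := hreach
  obtain ⟨n, rfl⟩ := Nat.exists_eq_succ_of_ne_zero hn.ne'
  exact exists_steps_fT_numeral n hu
end
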